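/- A Π̲_X-graph Q is an injective object of Set↓Π̲_X if and only if its nerve N(Q) is an injective object of the presheaf category of (X,Aut(X))-graphs, where N is the nerve of the interpretation I : 𝔾_{(X,Aut(X))} → Set↓Π̲_X. -/

import Mathlib

open CategoryTheory Limits Opposite

/-- The symmetric `X`-power functor `Π̲_X : Set ⥤ Set`: `Π̲_X(Y)` is the quotient of
`Y^X` by precomposition with the automorphism group `Aut X`. -/
def PiXF (X : Type) : Type ⥤ Type where
  obj Y := Quot (fun f g : X → Y => ∃ σ : Equiv.Perm X, f = g ∘ σ)
  map {Y Z} h := ↾(Quot.lift (fun f => Quot.mk _ (h ∘ f)) (by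
    rintro f g ⟨σ, rfl⟩
    exact Quot.sound ⟨σ, rfl⟩))
  map_id Y := by
    ext q
    induction q using Quot.ind with
    | _ f => rfl
  map_comp {Y Z W} h k := by
    ext q
    induction q using Quot.ind with
    | _ f => rfl

/-- The category of `Π̲_X`-graphs, the comma category `Set ↓ Π̲_X`. -/
abbrev PiGraph (X : Type) : Type 1 := Comma (𝟭 Type) (PiXF X)

/-- The two objects of the theory `𝔾_{(X, Aut X)}`. -/
inductive PObj (X : Type) : Type
  | V | A

namespace PObj

/-- Hom-sets of the theory `𝔾_{(X, Aut X)}`: `Hom(V,A) = X`, `Hom(A,A) = Aut X`. -/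
def Homs (X : Type) : PObj X → PObj X → Type
  | V, V => PUnit
  | V, A => X
  | A, V => PEmpty
  | A, A => Equiv.Perm X

/-- The theory `𝔾_{(X, Aut X)}`: composition is given by `σ ∘ x = σ(x)` and
`σ ∘ σ' = σ'σ` (the monoid `Aut X` with its diagrammatic multiplication). -/
instance (X : Type) : Category (PObj X) where
  Hom := Homs X
  id o := match o with
    | V => PUnit.unit
    | A => (1 : Equiv.Perm X)
  comp {a b c} f g := match a, b, c, f, g with
    | V, V, V, _, _ => PUnit.unit
    | V, V, A, _, x => x
    | V, A, V, _, e => e.elim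
    | V, A, A, x, σ => show X from (show Equiv.Perm X from σ) (show X from x)
    | A, V, _, e, _ => e.elim
    | A, A, V, _, e => e.elim
    | A, A, A, σ, τ => show Equiv.Perm X from (show Equiv.Perm X from τ) * (show Equiv.Perm X from σ)
  id_comp {a b} f := by
    cases a <;> cases b <;>
      first
        | exact f.elim
        | rfl
        | exact mul_one (show Equiv.Perm X from f)
  comp_id {a b} f := by
    cases a <;> cases b <;>
      first
        | exact f.elim
        | rfl
        | exact one_mul (show Equiv.Perm X from f)
  assoc {a b c d} f g h := by
    cases a <;> cases b <;> cases c <;> cases d <;>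
      first
        | exact f.elim
        | exact g.elim
        | exact h.elim
        | rfl
        | exact (mul_assoc (show Equiv.Perm X from h) (show Equiv.Perm X from g)
            (show Equiv.Perm X from f)).symm

end PObj

/-- The interpretation functor `I : 𝔾_{(X, Aut X)} ⥤ Set ↓ Π̲_X`: `V ↦ (∅, 1, !)`,
`A ↦ (1, X, ⌜q⌝)` where `q` is the class of `id_X` in `Π̲_X(X)`. -/
def InterpPi (X : Type) : PObj X ⥤ PiGraph X where
  obj o := match o with
    | .V => ⟨Empty, PUnit, ↾fun e => e.elim⟩
    | .A => ⟨PUnit, X, ↾fun _ => Quot.mk _ id⟩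
  map {a b} f := match a, b, f with
    | .V, .V, _ => 𝟙 _
    | .V, .A, x =>
        { left := ↾fun e => e.elim
          right := ↾fun _ => (show X from x)
          w := by ext e; exact e.elim }
    | .A, .V, e => e.elim
    | .A, .A, σ =>
        { left := ↾id
          right := ↾(show Equiv.Perm X from σ)
          w := by
            ext u
            exact Quot.sound (r := fun f g : X → X => ∃ τ : Equiv.Perm X, f = g ∘ τ)
              ⟨(show Equiv.Perm X from σ)⁻¹, by
                funext y; exact ((show Equiv.Perm X from σ).apply_symm_apply y).symm⟩ }
  map_id o := by
    cases o
    · rfl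
    · apply CommaMorphism.ext <;> rfl
  map_comp {a b c} f g := by
    cases a <;> cases b <;> cases c <;>
      first
        | exact f.elim
        | exact g.elim
        | apply CommaMorphism.ext <;> rfl

/-- The nerve `N := Hom(I(−), −) : Set ↓ Π̲_X ⥤ presheaves on 𝔾_{(X, Aut X)}`. -/
noncomputable def nervePi (X : Type) : PiGraph X ⥤ ((PObj X)ᵒᵖ ⥤ Type) :=
  yoneda ⋙ (Functor.whiskeringLeft _ _ (Type)).obj (Functor.op (InterpPi X))

namespace PiProof

variable {X : Type}

/-- The relation defining `PiXF`. -/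
def rel (X Y : Type) : (X → Y) → (X → Y) → Prop := fun f g => ∃ σ : Equiv.Perm X, f = g ∘ σ

theorem rel_equiv (X Y : Type) : Equivalence (rel X Y) where
  refl f := ⟨1, rfl⟩
  symm := by
    rintro f g ⟨σ, rfl⟩
    exact ⟨σ⁻¹, by funext y; exact congrArg g (σ.apply_symm_apply y).symm⟩
  trans := by
    rintro f g h ⟨σ, rfl⟩ ⟨τ, rfl⟩
    exact ⟨τ * σ, rfl⟩

theorem rel_of_eq {Y : Type} {f g : X → Y}
    (h : (Quot.mk (rel X Y) f) = Quot.mk (rel X Y) g) : rel X Y f g :=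
  (rel_equiv X Y).eqvGen_iff.1 (Quot.eqvGen_exact h)

/-- Class of a function in the symmetric power. -/
def cls {Y : Type} (f : X → Y) : (PiXF X).obj Y := Quot.mk (rel X Y) f

theorem map_cls {Y Z : Type} (h : Y ⟶ Z) (f : X → Y) :
    (PiXF X).map h (cls f) = cls (fun x => h (f x)) := rfl

theorem exists_cls {Y : Type} (q : (PiXF X).obj Y) : ∃ f : X → Y, q = cls f := by
  obtain ⟨f, hf⟩ := Quot.exists_rep q
  exact ⟨f, hf.symm⟩

/-- The object `I(V)`. -/
abbrev iV (X : Type) : PiGraph X := (InterpPi X).obj .V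
/-- The object `I(A)`. -/
abbrev iA (X : Type) : PiGraph X := (InterpPi X).obj .A

/-- The morphism `I(V) ⟶ G` given by a vertex. -/
def vHom (G : PiGraph X) (v : G.right) : iV X ⟶ G where
  left := ↾fun e => (show Empty from e).elim
  right := ↾fun _ => v
  w := by ext e; exact (show Empty from e).elim

/-- The morphism `I(A) ⟶ G` given by an edge and a representative of its incidence. -/
def arcHom (G : PiGraph X) (e : G.left) (f : X → G.right) (h : G.hom e = cls f) :
    iA X ⟶ G where
  left := ↾fun _ => e
  right := ↾f
  w := by ext u; exact h

/-- The vertex of a morphism from `I(V)`. -/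
def vx {G : PiGraph X} (a : iV X ⟶ G) : G.right := a.right PUnit.unit
/-- The edge of a morphism from `I(A)`. -/
def ed {G : PiGraph X} (a : iA X ⟶ G) : G.left := a.left PUnit.unit
/-- The incidence representative of a morphism from `I(A)`. -/
def inc {G : PiGraph X} (a : iA X ⟶ G) (x : X) : G.right := a.right x

theorem hom_w {G H : PiGraph X} (a : G ⟶ H) (e : G.left) :
    H.hom (a.left e) = (PiXF X).map a.right (G.hom e) :=
  types_congr_hom a.w e

theorem arc_w {G : PiGraph X} (a : iA X ⟶ G) : G.hom (ed a) = cls (inc a) :=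
  types_congr_hom a.w PUnit.unit

theorem vext {G : PiGraph X} {a b : iV X ⟶ G} (h : vx a = vx b) : a = b := by
  apply CommaMorphism.ext
  · ext e; exact (show Empty from e).elim
  · ext u; exact h

theorem aext {G : PiGraph X} {a b : iA X ⟶ G} (h : ed a = ed b)
    (h' : ∀ x, inc a x = inc b x) : a = b := by
  apply CommaMorphism.ext
  · ext e; exact h
  · ext u; exact h' u

/-- The morphism `V ⟶ A` of the theory. -/
def tx (x : X) : (PObj.V : PObj X) ⟶ PObj.A := x
/-- The morphism `A ⟶ A` of the theory. -/
def ts (σ : Equiv.Perm X) : (PObj.A : PObj X) ⟶ PObj.A := σ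

theorem tx_ts (x : X) (σ : Equiv.Perm X) : tx x ≫ ts σ = tx (σ x) := rfl
theorem ts_ts (σ τ : Equiv.Perm X) : ts σ ≫ ts τ = ts (τ * σ) := rfl
theorem ts_one : ts (1 : Equiv.Perm X) = 𝟙 _ := rfl

theorem same_ed {G : PiGraph X} {a b : iA X ⟶ G} (h : ed a = ed b) :
    ∃ σ : Equiv.Perm X, a = (InterpPi X).map (ts σ) ≫ b := by
  have h1 : cls (inc a) = cls (inc b) := by rw [← arc_w, ← arc_w, h]
  obtain ⟨σ, hσ⟩ := rel_of_eq h1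
  refine ⟨σ, aext h fun x => ?_⟩
  exact congrFun hσ x

theorem exists_arc (G : PiGraph X) (e : G.left) : ∃ a : iA X ⟶ G, ed a = e := by
  obtain ⟨f, hf⟩ := exists_cls (G.hom e)
  exact ⟨arcHom G e f hf, rfl⟩

section full
variable {G Q : PiGraph X} (t : (nervePi X).obj G ⟶ (nervePi X).obj Q)

/-- Component at `V`. -/
def tV (a : iV X ⟶ G) : iV X ⟶ Q := t.app (op .V) a
/-- Component at `A`. -/
def tA (a : iA X ⟶ G) : iA X ⟶ Q := t.app (op .A) a

theorem tA_nat (σ : Equiv.Perm X) (a : iA X ⟶ G) :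
    tA t ((InterpPi X).map (ts σ) ≫ a) = (InterpPi X).map (ts σ) ≫ tA t a :=
  types_congr_hom (t.naturality (ts σ).op) a

theorem tV_nat (x : X) (a : iA X ⟶ G) :
    tV t ((InterpPi X).map (tx x) ≫ a) = (InterpPi X).map (tx x) ≫ tA t a :=
  types_congr_hom (t.naturality (tx x).op) a

theorem tA_ed {a b : iA X ⟶ G} (h : ed a = ed b) : ed (tA t a) = ed (tA t b) := by
  obtain ⟨σ, rfl⟩ := same_ed h
  rw [tA_nat]
  rfl

theorem tA_inc (a : iA X ⟶ G) (x : X) : inc (tA t a) x = vx (tV t (vHom G (inc a x))) := by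
  have : vHom G (inc a x) = (InterpPi X).map (tx x) ≫ a := vext rfl
  rw [this, tV_nat]
  rfl

/-- Fullness of the nerve. -/
noncomputable def fullHom : G ⟶ Q where
  left := ↾fun e => ed (tA t (exists_arc G e).choose)
  right := ↾fun v => vx (tV t (vHom G v))
  w := by
    ext e
    have h := (exists_arc G e).choose_spec
    set a := (exists_arc G e).choose with ha
    change Q.hom (ed (tA t (exists_arc G e).choose)) = (PiXF X).map _ (G.hom e)
    rw [← ha, arc_w, ← h, arc_w, map_cls]
    congr 1
    funext x
    exact tA_inc t a x

theorem fullHom_left (a : iA X ⟶ G) : (fullHom t).left (ed a) = ed (tA t a) :=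
  tA_ed t (exists_arc G (ed a)).choose_spec

end full

theorem injective_of_nerve (Q : PiGraph X) [Injective ((nervePi X).obj Q)] : Injective Q where
  factors {G H} h m _ := by
    haveI : Mono ((nervePi X).map m) := by
      rw [NatTrans.mono_iff_mono_app]
      intro k
      rw [mono_iff_injective]
      intro a b hab
      exact (cancel_mono m).1 hab
    obtain ⟨t, ht⟩ := Injective.factors ((nervePi X).map h) ((nervePi X).map m)
    refine ⟨fullHom t, ?_⟩
    have hV : ∀ a : iV X ⟶ G, tV t (a ≫ m) = a ≫ h := fun a =>
      types_congr_hom (congrArg (fun s => NatTrans.app s (op .V)) ht) a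
    have hA : ∀ a : iA X ⟶ G, tA t (a ≫ m) = a ≫ h := fun a =>
      types_congr_hom (congrArg (fun s => NatTrans.app s (op .A)) ht) a
    apply CommaMorphism.ext
    · ext e
      obtain ⟨a, rfl⟩ := exists_arc G e
      have := fullHom_left t (a ≫ m)
      rw [hA] at this
      exact this
    · ext v
      have := hV (vHom G v)
      have h2 : vHom G v ≫ m = vHom H (m.right v) := vext rfl
      rw [h2] at this
      exact congrArg vx this

/-! ### The realization -/

section real
variable (P : (PObj X)ᵒᵖ ⥤ Type)

/-- Vertex of an arc of a presheaf. -/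
def pv (a : P.obj (op .A)) (x : X) : P.obj (op .V) := P.map (tx x).op a
/-- Action of `Aut X` on arcs. -/
def pa (σ : Equiv.Perm X) (a : P.obj (op .A)) : P.obj (op .A) := P.map (ts σ).op a

theorem pv_pa (σ : Equiv.Perm X) (a : P.obj (op .A)) (x : X) :
    pv P (pa P σ a) x = pv P a (σ x) := by
  have h := Functor.map_comp_apply P (ts σ).op (tx x).op a
  exact h.symm

theorem pa_pa (σ τ : Equiv.Perm X) (a : P.obj (op .A)) :
    pa P σ (pa P τ a) = pa P (τ * σ) a :=
  (Functor.map_comp_apply P (ts τ).op (ts σ).op a).symm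

theorem pa_one (a : P.obj (op .A)) : pa P 1 a = a :=
  Functor.map_id_apply P _ a

/-- Orbit relation. -/
def orel (a b : P.obj (op .A)) : Prop := ∃ σ, a = pa P σ b

theorem orel_equiv : Equivalence (orel P) where
  refl a := ⟨1, (pa_one P a).symm⟩
  symm := by
    rintro a b ⟨σ, rfl⟩
    exact ⟨σ⁻¹, by rw [pa_pa, mul_inv_cancel, pa_one]⟩
  trans := by
    rintro a b c ⟨σ, rfl⟩ ⟨τ, rfl⟩
    exact ⟨τ * σ, pa_pa _ _ _ _⟩

theorem orel_of_eq {a b : P.obj (op .A)} (h : Quot.mk (orel P) a = Quot.mk (orel P) b) :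
    orel P a b :=
  (orel_equiv P).eqvGen_iff.1 (Quot.eqvGen_exact h)

/-- Realization of a presheaf. -/
def real : PiGraph X where
  left := Quot (orel P)
  right := P.obj (op .V)
  hom := ↾(Quot.lift (fun a => cls (pv P a)) (by
    rintro a b ⟨σ, rfl⟩
    exact Quot.sound ⟨σ, funext fun x => pv_pa P σ b x⟩))

variable {P} {P' : (PObj X)ᵒᵖ ⥤ Type} (m : P ⟶ P')

theorem m_pa (σ : Equiv.Perm X) (a : P.obj (op .A)) :
    m.app (op .A) (pa P σ a) = pa P' σ (m.app (op .A) a) :=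
  types_congr_hom (m.naturality (ts σ).op) a

theorem m_pv (x : X) (a : P.obj (op .A)) :
    m.app (op .V) (pv P a x) = pv P' (m.app (op .A) a) x :=
  types_congr_hom (m.naturality (tx x).op) a

/-- Realization of a morphism. -/
def realMap : real P ⟶ real P' where
  left := ↾(Quot.lift (fun a => Quot.mk (orel P') (m.app (op .A) a)) (by
    rintro a b ⟨σ, rfl⟩
    exact Quot.sound ⟨σ, m_pa m σ b⟩))
  right := m.app (op .V)
  w := by
    ext q
    induction q using Quot.ind with
    | _ a =>
      change cls (pv P' (m.app (op .A) a)) = cls (fun x => m.app (op .V) (pv P a x))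
      congr 1
      funext x
      exact (m_pv m x a).symm

theorem realMap_mono [Mono m] : Mono (realMap m) := by
  have hm : ∀ k, Function.Injective (m.app k) := fun k =>
    (mono_iff_injective _).1 ((NatTrans.mono_iff_mono_app m).1 inferInstance k)
  have hl : Function.Injective (realMap m).left := by
    intro p q
    induction p using Quot.ind with
    | _ a =>
    induction q using Quot.ind with
    | _ b =>
      intro h
      obtain ⟨σ, hσ⟩ := orel_of_eq P' h
      rw [← m_pa] at hσ
      exact Quot.sound ⟨σ, hm _ hσ⟩
  have hr : Function.Injective (realMap m).right := hm _
  constructor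
  intro Z g h hgh
  apply CommaMorphism.ext
  · ext z
    exact hl (types_congr_hom (congrArg CommaMorphism.left hgh) z)
  · ext z
    exact hr (types_congr_hom (congrArg CommaMorphism.right hgh) z)

variable {Q : PiGraph X} (h : P ⟶ (nervePi X).obj Q)

/-- Component at `V`. -/
def hV (a : P.obj (op .V)) : iV X ⟶ Q := h.app (op .V) a
/-- Component at `A`. -/
def hA (a : P.obj (op .A)) : iA X ⟶ Q := h.app (op .A) a

theorem hA_pa (σ : Equiv.Perm X) (a : P.obj (op .A)) :
    hA h (pa P σ a) = (InterpPi X).map (ts σ) ≫ hA h a :=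
  types_congr_hom (h.naturality (ts σ).op) a

theorem hV_pv (x : X) (a : P.obj (op .A)) :
    hV h (pv P a x) = (InterpPi X).map (tx x) ≫ hA h a :=
  types_congr_hom (h.naturality (tx x).op) a

/-- Transpose of a morphism to a nerve. -/
def transp : real P ⟶ Q where
  left := ↾(Quot.lift (fun a => ed (hA h a)) (by
    rintro a b ⟨σ, rfl⟩
    rw [hA_pa]
    rfl))
  right := ↾fun v => vx (hV h v)
  w := by
    ext q
    induction q using Quot.ind with
    | _ a =>
      change Q.hom (ed (hA h a)) = cls (fun x => vx (hV h (pv P a x)))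
      rw [arc_w]
      congr 1
      funext x
      rw [hV_pv]
      rfl

variable (P) in
/-- The unit. -/
def unitApp : (k : (PObj X)ᵒᵖ) → P.obj k → ((nervePi X).obj (real P)).obj k
  | op .V, v => vHom (real P) v
  | op .A, a => arcHom (real P) (Quot.mk _ a) (pv P a) rfl

variable (P) in
/-- The unit. -/
def unitHom : P ⟶ (nervePi X).obj (real P) where
  app k := ↾(unitApp P k)
  naturality := by
    rintro ⟨k⟩ ⟨l⟩ ⟨f⟩
    ext a
    cases k <;> cases l
    · have : f = 𝟙 _ := rfl
      subst this
      exact vext (Functor.map_id_apply P (op PObj.V) a)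
    · exact f.elim
    · exact vext rfl
    · exact aext (Quot.sound ⟨f, rfl⟩) fun x => pv_pa P f a x

end real

theorem injective_nerve (Q : PiGraph X) [Injective Q] : Injective ((nervePi X).obj Q) where
  factors {P P'} h m _ := by
    haveI := realMap_mono m
    obtain ⟨k, hk⟩ := Injective.factors (transp h) (realMap m)
    refine ⟨unitHom P' ≫ (nervePi X).map k, ?_⟩
    have hl : ∀ e, k.left ((realMap m).left e) = (transp h).left e := fun e =>
      types_congr_hom (congrArg CommaMorphism.left hk) e
    have hr : ∀ e, k.right ((realMap m).right e) = (transp h).right e := fun e =>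
      types_congr_hom (congrArg CommaMorphism.right hk) e
    ext ⟨o⟩ a
    cases o
    · exact vext (hr a)
    · refine aext (hl (Quot.mk _ a)) fun x => ?_
      change k.right (pv P' (m.app (op .A) a) x) = inc (hA h a) x
      rw [← m_pv]
      refine (hr (pv P a x)).trans ?_
      change vx (hV h (pv P a x)) = _
      rw [hV_pv]
      rfl

end PiProof

/-- A `Π̲_X`-graph `Q` is an injective object of `Set ↓ Π̲_X` iff its nerve
`N(Q)` is an injective object of the presheaf category of `(X, Aut X)`-graphs. -/
theorem statement17 (X : Type) (Q : PiGraph X) :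
    Injective Q ↔ Injective ((nervePi X).obj Q) := by
  exact ⟨fun _ => PiProof.injective_nerve Q, fun _ => PiProof.injective_of_nerve Q⟩
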